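/- arXiv:gr-qc/9906087 — 3 statements merged into one kernel-verified Lean document; each statement's English description precedes it below -/
import Mathlib

section
/- Let n = 5 and let C be a Weyl candidate on 5-dimensional Minkowski space. Then its generalized Bel–Robinson tensor 𝒯 is completely symmetric: 𝒯_{αβλμ} is invariant under every permutation of the four indices (α, β, λ, μ). -/
open Finset

noncomputable section

/-- Components of the Minkowski metric (and of its inverse) in dimension `n`. -/
def gmet (n : ℕ) (μ ν : Fin n) : ℝ :=
  if μ = ν then (if (μ : ℕ) = 0 then -1 else 1) else 0

/-- A Weyl candidate: pair antisymmetries, pair interchange symmetry,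
first Bianchi identity, and trace-free. -/
def IsWeylCandidate (n : ℕ) (C : Fin n → Fin n → Fin n → Fin n → ℝ) : Prop :=
  (∀ a b c d, C a b c d = - C b a c d) ∧
  (∀ a b c d, C a b c d = - C a b d c) ∧
  (∀ a b c d, C a b c d = C c d a b) ∧
  (∀ a b c d, C a b c d + C a c d b + C a d b c = 0) ∧
  (∀ b d, (∑ a : Fin n, ∑ c : Fin n, gmet n a c * C a b c d) = 0)

/-- The generalized Bel(-Robinson) tensor of a double symmetric `(2,2)`-form `C`:
`𝒯_{αβλμ} = C_{αρλσ} C_β{}^ρ{}_μ{}^σ + C_{αρμσ} C_β{}^ρ{}_λ{}^σ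
  − (1/2)η_{αβ} C_{ρτλσ} C^{ρτ}{}_μ{}^σ − (1/2)η_{λμ} C_{αρστ} C_β{}^{ρστ}
  + (1/8)η_{αβ}η_{λμ} C_{ρτσν} C^{ρτσν}`. -/
def belT (n : ℕ) (C : Fin n → Fin n → Fin n → Fin n → ℝ) (α β lam mu : Fin n) : ℝ :=
  (∑ ρ : Fin n, ∑ ρ' : Fin n, ∑ σ : Fin n, ∑ σ' : Fin n,
      gmet n ρ ρ' * gmet n σ σ' * C α ρ lam σ * C β ρ' mu σ')
  + (∑ ρ : Fin n, ∑ ρ' : Fin n, ∑ σ : Fin n, ∑ σ' : Fin n,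
      gmet n ρ ρ' * gmet n σ σ' * C α ρ mu σ * C β ρ' lam σ')
  - (1 / 2) * gmet n α β *
      (∑ ρ : Fin n, ∑ ρ' : Fin n, ∑ τ : Fin n, ∑ τ' : Fin n, ∑ σ : Fin n, ∑ σ' : Fin n,
        gmet n ρ ρ' * gmet n τ τ' * gmet n σ σ' * C ρ τ lam σ * C ρ' τ' mu σ')
  - (1 / 2) * gmet n lam mu *
      (∑ ρ : Fin n, ∑ ρ' : Fin n, ∑ σ : Fin n, ∑ σ' : Fin n, ∑ τ : Fin n, ∑ τ' : Fin n,
        gmet n ρ ρ' * gmet n σ σ' * gmet n τ τ' * C α ρ σ τ * C β ρ' σ' τ')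
  + (1 / 8) * gmet n α β * gmet n lam mu *
      (∑ ρ : Fin n, ∑ ρ' : Fin n, ∑ τ : Fin n, ∑ τ' : Fin n, ∑ σ : Fin n, ∑ σ' : Fin n,
       ∑ ν : Fin n, ∑ ν' : Fin n,
        gmet n ρ ρ' * gmet n τ τ' * gmet n σ σ' * gmet n ν ν' * C ρ τ σ ν * C ρ' τ' σ' ν')

/-- The Euclidean contraction `D_{αρλσ} D_{βρμσ}`. -/
def bP (D : Fin 5 → Fin 5 → Fin 5 → Fin 5 → ℂ) (α β l m : Fin 5) : ℂ :=
  ∑ ρ : Fin 5, ∑ σ : Fin 5, D α ρ l σ * D β ρ m σ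

/-- The Euclidean contraction `D_{ρτλσ} D_{ρτμσ}`. -/
def bQ (D : Fin 5 → Fin 5 → Fin 5 → Fin 5 → ℂ) (l m : Fin 5) : ℂ :=
  ∑ ρ : Fin 5, bP D ρ ρ l m

/-- Kronecker delta. -/
def kd (a b : Fin 5) : ℂ := if a = b then 1 else 0

/-- Euclidean version of the Bel-Robinson tensor. -/
def bT (D : Fin 5 → Fin 5 → Fin 5 → Fin 5 → ℂ) (α β l m : Fin 5) : ℂ :=
  bP D α β l m + bP D α β m l - 1 / 2 * kd α β * bQ D l m - 1 / 2 * kd l m * bQ D α β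
    + 1 / 8 * kd α β * kd l m * ∑ i : Fin 5, bQ D i i

/-- Euclidean complex Weyl candidates. -/
structure EW (D : Fin 5 → Fin 5 → Fin 5 → Fin 5 → ℂ) : Prop where
  h1 : ∀ a b c d, D a b c d = - D b a c d
  h2 : ∀ a b c d, D a b c d = - D a b d c
  h3 : ∀ a b c d, D a b c d = D c d a b
  h4 : ∀ a b c d, D a b c d + D a c d b + D a d b c = 0
  h5 : ∀ b d, (∑ a : Fin 5, D a b a d) = 0

set_option maxHeartbeats 4000000 in
lemma cases_concrete (D : Fin 5 → Fin 5 → Fin 5 → Fin 5 → ℂ) (hD : EW D) :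
    bT D 0 1 2 3 = bT D 0 2 1 3 ∧ bT D 0 0 1 2 = bT D 0 1 0 2 ∧ bT D 0 0 1 1 = bT D 0 1 0 1 := by
  obtain ⟨h1, h2, h3, h4, h5⟩ := hD
  have z1 : ∀ a c d, D a a c d = 0 := fun a c d => by linear_combination (1 / 2) * h1 a a c d
  have z2 : ∀ a b c, D a b c c = 0 := fun a b c => by linear_combination (1 / 2) * h2 a b c c
  have B0123 : D 0 3 1 2 = D 0 2 1 3 - D 0 1 2 3 := by
    linear_combination h4 0 1 2 3 - h2 0 2 3 1
  have B0124 : D 0 4 1 2 = D 0 2 1 4 - D 0 1 2 4 := by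
    linear_combination h4 0 1 2 4 - h2 0 2 4 1
  have B0134 : D 0 4 1 3 = D 0 3 1 4 - D 0 1 3 4 := by
    linear_combination h4 0 1 3 4 - h2 0 3 4 1
  have B0234 : D 0 4 2 3 = D 0 3 2 4 - D 0 2 3 4 := by
    linear_combination h4 0 2 3 4 - h2 0 3 4 2
  have B1234 : D 1 4 2 3 = D 1 3 2 4 - D 1 2 3 4 := by
    linear_combination h4 1 2 3 4 - h2 1 3 4 2
  simp only [Fin.sum_univ_five] at h5
  have N5 : ∀ b d, D 0 b 0 d + D 1 b 1 d + D 2 b 2 d + D 3 b 3 d + D 4 b 4 d = 0 := h5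
  have O01 : D 0 4 1 4 = 0 - D 0 2 1 2 - D 0 3 1 3 := by
    linear_combination (N5 0 1 - z1 0 0 1 - z2 1 0 1 - h1 2 0 2 1 + h2 0 2 2 1 - h1 3 0 3 1 + h2 0 3 3 1 - h1 4 0 4 1 + h2 0 4 4 1)
  have O02 : D 0 4 2 4 = 0 + D 0 1 1 2 - D 0 3 2 3 := by
    linear_combination (N5 0 2 - z1 0 0 2 - h1 1 0 1 2 - z2 2 0 2 - h1 3 0 3 2 + h2 0 3 3 2 - h1 4 0 4 2 + h2 0 4 4 2)
  have O03 : D 0 4 3 4 = 0 + D 0 1 1 3 + D 0 2 2 3 := by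
    linear_combination (N5 0 3 - z1 0 0 3 - h1 1 0 1 3 - h1 2 0 2 3 - z2 3 0 3 - h1 4 0 4 3 + h2 0 4 4 3)
  have O04 : D 0 3 3 4 = 0 - D 0 1 1 4 - D 0 2 2 4 := by
    linear_combination -(N5 0 4 - z1 0 0 4 - h1 1 0 1 4 - h1 2 0 2 4 - h1 3 0 3 4 - z2 4 0 4)
  have O12 : D 1 4 2 4 = 0 - D 0 1 0 2 - D 1 3 2 3 := by
    linear_combination (N5 1 2 - z1 1 1 2 - z2 2 1 2 - h1 3 1 3 2 + h2 1 3 3 2 - h1 4 1 4 2 + h2 1 4 4 2)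
  have O13 : D 1 4 3 4 = 0 - D 0 1 0 3 + D 1 2 2 3 := by
    linear_combination (N5 1 3 - z1 1 1 3 - h1 2 1 2 3 - z2 3 1 3 - h1 4 1 4 3 + h2 1 4 4 3)
  have O14 : D 1 3 3 4 = 0 + D 0 1 0 4 - D 1 2 2 4 := by
    linear_combination -(N5 1 4 - z1 1 1 4 - h1 2 1 2 4 - h1 3 1 3 4 - z2 4 1 4)
  have O23 : D 2 4 3 4 = 0 - D 0 2 0 3 - D 1 2 1 3 := by
    linear_combination (N5 2 3 - z1 2 2 3 - z2 3 2 3 - h1 4 2 4 3 + h2 2 4 4 3)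
  have O24 : D 2 3 3 4 = 0 + D 0 2 0 4 + D 1 2 1 4 := by
    linear_combination -(N5 2 4 - z1 2 2 4 - h1 3 2 3 4 - z2 4 2 4)
  have O34 : D 2 3 2 4 = 0 - D 0 3 0 4 - D 1 3 1 4 := by
    linear_combination (N5 3 4 - z1 3 3 4 - z2 4 3 4)
  have E0 : D 0 1 0 1 + D 0 2 0 2 + D 0 3 0 3 + D 0 4 0 4 = 0 := by
    linear_combination N5 0 0 - z1 0 0 0 - h1 1 0 1 0 + h2 0 1 1 0 - h1 2 0 2 0 + h2 0 2 2 0 - h1 3 0 3 0 + h2 0 3 3 0 - h1 4 0 4 0 + h2 0 4 4 0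
  have E1 : D 0 1 0 1 + D 1 2 1 2 + D 1 3 1 3 + D 1 4 1 4 = 0 := by
    linear_combination N5 1 1 - z1 1 1 1 - h1 2 1 2 1 + h2 1 2 2 1 - h1 3 1 3 1 + h2 1 3 3 1 - h1 4 1 4 1 + h2 1 4 4 1
  have E2 : D 0 2 0 2 + D 1 2 1 2 + D 2 3 2 3 + D 2 4 2 4 = 0 := by
    linear_combination N5 2 2 - z1 2 2 2 - h1 3 2 3 2 + h2 2 3 3 2 - h1 4 2 4 2 + h2 2 4 4 2
  have E3 : D 0 3 0 3 + D 1 3 1 3 + D 2 3 2 3 + D 3 4 3 4 = 0 := by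
    linear_combination N5 3 3 - z1 3 3 3 - h1 4 3 4 3 + h2 3 4 4 3
  have E4 : D 0 4 0 4 + D 1 4 1 4 + D 2 4 2 4 + D 3 4 3 4 = 0 := by
    linear_combination N5 4 4 - z1 4 4 4
  have K04 : D 0 4 0 4 = -D 0 1 0 1 - D 0 2 0 2 - D 0 3 0 3 := by
    linear_combination E0
  have K14 : D 1 4 1 4 = -D 0 1 0 1 - D 1 2 1 2 - D 1 3 1 3 := by
    linear_combination E1
  have K23 : D 2 3 2 3 = -D 0 1 0 1 - D 0 2 0 2 - D 0 3 0 3 - D 1 2 1 2 - D 1 3 1 3 := by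
    linear_combination (E0 + E1 + E2 + E3 - E4) / 2
  have K24 : D 2 4 2 4 = D 0 1 0 1 + D 0 3 0 3 + D 1 3 1 3 := by
    linear_combination E2 - (E0 + E1 + E2 + E3 - E4) / 2
  have K34 : D 3 4 3 4 = D 0 1 0 1 + D 0 2 0 2 + D 1 2 1 2 := by
    linear_combination E3 - (E0 + E1 + E2 + E3 - E4) / 2
  refine ⟨?_, ?_, ?_⟩ <;>
  · simp only [bT, bQ, bP, kd, Fin.sum_univ_five, Fin.reduceEq, if_true, if_false,
      mul_zero, zero_mul, mul_one]
    simp only [z1, z2,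
    h1 1 0, h1 2 0, h1 3 0, h1 4 0, h1 2 1, h1 3 1, h1 4 1, h1 3 2, h1 4 2, h1 4 3, (fun p q =>
    h2 p q 1 0), (fun p q => h2 p q 2 0), (fun p q => h2 p q 3 0), (fun p q => h2 p q 4 0),
    (fun p q => h2 p q 2 1), (fun p q => h2 p q 3 1), (fun p q => h2 p q 4 1), (fun p q => h2 p
    q 3 2), (fun p q => h2 p q 4 2), (fun p q => h2 p q 4 3), h3 0 2 0 1, h3 0 3 0 1, h3 0 3 0
    2, h3 0 4 0 1, h3 0 4 0 2, h3 0 4 0 3, h3 1 2 0 1, h3 1 2 0 2, h3 1 2 0 3, h3 1 2 0 4, h3 1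
    3 0 1, h3 1 3 0 2, h3 1 3 0 3, h3 1 3 0 4, h3 1 3 1 2, h3 1 4 0 1, h3 1 4 0 2, h3 1 4 0 3,
    h3 1 4 0 4, h3 1 4 1 2, h3 1 4 1 3, h3 2 3 0 1, h3 2 3 0 2, h3 2 3 0 3, h3 2 3 0 4, h3 2 3
    1 2, h3 2 3 1 3, h3 2 3 1 4, h3 2 4 0 1, h3 2 4 0 2, h3 2 4 0 3, h3 2 4 0 4, h3 2 4 1 2, h3
    2 4 1 3, h3 2 4 1 4, h3 2 4 2 3, h3 3 4 0 1, h3 3 4 0 2, h3 3 4 0 3, h3 3 4 0 4, h3 3 4 1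
    2, h3 3 4 1 3, h3 3 4 1 4, h3 3 4 2 3, h3 3 4 2 4,
    B0123, B0124, B0134, B0234, B1234, O01, O02, O03, O04, O12, O13, O14, O23, O24, O34, K04,
    K14, K23, K24, K34, mul_zero, zero_mul, add_zero, zero_add]
    ring

lemma bP_comp (D : Fin 5 → Fin 5 → Fin 5 → Fin 5 → ℂ) (e : Equiv.Perm (Fin 5)) (α β l m : Fin 5) :
    bP (fun a b c d => D (e a) (e b) (e c) (e d)) α β l m = bP D (e α) (e β) (e l) (e m) := by
  unfold bP
  rw [← Equiv.sum_comp e (fun ρ => ∑ σ : Fin 5, D (e α) ρ (e l) σ * D (e β) ρ (e m) σ)]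
  refine Finset.sum_congr rfl fun ρ _ => ?_
  rw [← Equiv.sum_comp e (fun σ => D (e α) (e ρ) (e l) σ * D (e β) (e ρ) (e m) σ)]

lemma bQ_comp (D : Fin 5 → Fin 5 → Fin 5 → Fin 5 → ℂ) (e : Equiv.Perm (Fin 5)) (l m : Fin 5) :
    bQ (fun a b c d => D (e a) (e b) (e c) (e d)) l m = bQ D (e l) (e m) := by
  unfold bQ
  rw [← Equiv.sum_comp e (fun ρ => bP D ρ ρ (e l) (e m))]
  refine Finset.sum_congr rfl fun ρ _ => bP_comp D e _ _ _ _

lemma bT_comp (D : Fin 5 → Fin 5 → Fin 5 → Fin 5 → ℂ) (e : Equiv.Perm (Fin 5)) (α β l m : Fin 5) :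
    bT (fun a b c d => D (e a) (e b) (e c) (e d)) α β l m = bT D (e α) (e β) (e l) (e m) := by
  unfold bT
  simp only [bP_comp, bQ_comp, kd, e.injective.eq_iff]
  rw [Equiv.sum_comp e (fun i => bQ D i i)]

lemma EW.comp {D : Fin 5 → Fin 5 → Fin 5 → Fin 5 → ℂ} (hD : EW D) (e : Equiv.Perm (Fin 5)) :
    EW (fun a b c d => D (e a) (e b) (e c) (e d)) where
  h1 a b c d := hD.h1 _ _ _ _
  h2 a b c d := hD.h2 _ _ _ _
  h3 a b c d := hD.h3 _ _ _ _
  h4 a b c d := hD.h4 _ _ _ _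
  h5 b d := by
    rw [Equiv.sum_comp e (fun a => D a (e b) a (e d))]
    exact hD.h5 _ _

lemma exists_perm4 (a b c d : Fin 5) (hab : a ≠ b) (hac : a ≠ c) (had : a ≠ d) (hbc : b ≠ c)
    (hbd : b ≠ d) (hcd : c ≠ d) :
    ∃ e : Equiv.Perm (Fin 5), e 0 = a ∧ e 1 = b ∧ e 2 = c ∧ e 3 = d := by
  obtain ⟨x, hx⟩ : ∃ x : Fin 5, x ∉ ({a, b, c, d} : Finset (Fin 5)) := by
    by_contra! h
    have h1 := Finset.card_le_card (fun x _ => h x : (Finset.univ : Finset (Fin 5)) ⊆ _)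
    have h2 : ({a, b, c, d} : Finset (Fin 5)).card ≤ 4 := Finset.card_le_four
    simp at h1
    omega
  simp only [Finset.mem_insert, Finset.mem_singleton, not_or] at hx
  obtain ⟨h1, h2, h3, h4⟩ := hx
  have hinj : Function.Injective ![a, b, c, d, x] := by
    intro i j hij
    fin_cases i <;> fin_cases j <;> simp_all [eq_comm]
  refine ⟨Equiv.ofBijective _ (Finite.injective_iff_bijective.mp hinj), ?_, ?_, ?_, ?_⟩ <;> simp

lemma bP_swap {D : Fin 5 → Fin 5 → Fin 5 → Fin 5 → ℂ} (α β l m : Fin 5) :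
    bP D α β l m = bP D β α m l := by
  unfold bP
  exact Finset.sum_congr rfl fun _ _ => Finset.sum_congr rfl fun _ _ => mul_comm _ _

lemma bP_pair {D : Fin 5 → Fin 5 → Fin 5 → Fin 5 → ℂ} (hD : EW D) (α β l m : Fin 5) :
    bP D α β l m = bP D l m α β := by
  unfold bP
  rw [Finset.sum_comm]
  exact Finset.sum_congr rfl fun _ _ => Finset.sum_congr rfl fun _ _ => by
    rw [hD.h3 α, hD.h3 β]

lemma bQ_symm {D : Fin 5 → Fin 5 → Fin 5 → Fin 5 → ℂ} (l m : Fin 5) : bQ D l m = bQ D m l := by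
  unfold bQ
  exact Finset.sum_congr rfl fun _ _ => bP_swap _ _ _ _

lemma kd_symm (a b : Fin 5) : kd a b = kd b a := by simp [kd, eq_comm]

lemma bT_12 {D : Fin 5 → Fin 5 → Fin 5 → Fin 5 → ℂ} (α β l m : Fin 5) :
    bT D α β l m = bT D β α l m := by
  unfold bT
  rw [bP_swap α β l m, bP_swap α β m l, kd_symm α β, bQ_symm α β]
  ring

lemma bT_pair {D : Fin 5 → Fin 5 → Fin 5 → Fin 5 → ℂ} (hD : EW D) (α β l m : Fin 5) :
    bT D α β l m = bT D l m α β := by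
  unfold bT
  rw [bP_pair hD α β l m, bP_pair hD α β m l, bP_swap m l α β]
  ring

lemma bT_34 {D : Fin 5 → Fin 5 → Fin 5 → Fin 5 → ℂ} (hD : EW D) (α β l m : Fin 5) :
    bT D α β l m = bT D α β m l := by
  rw [bT_pair hD, bT_12, bT_pair hD]

lemma bT_aabc {D : Fin 5 → Fin 5 → Fin 5 → Fin 5 → ℂ} (hD : EW D) (a b c : Fin 5)
    (hab : a ≠ b) (hac : a ≠ c) : bT D a a b c = bT D a b a c := by
  by_cases hbc : b = c
  · subst hbc
    obtain ⟨x, y, hx⟩ : ∃ x y : Fin 5, a ≠ x ∧ a ≠ y ∧ b ≠ x ∧ b ≠ y ∧ x ≠ y := by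
      revert a b; decide
    obtain ⟨e, h0, h1, -, -⟩ := exists_perm4 a b x y hab hx.1 hx.2.1 hx.2.2.1 hx.2.2.2.1 hx.2.2.2.2
    have := (cases_concrete _ (hD.comp e)).2.2
    simpa only [bT_comp, h0, h1] using this
  · obtain ⟨x, hx⟩ : ∃ x : Fin 5, a ≠ x ∧ b ≠ x ∧ c ≠ x := by
      clear hab hac hbc
      revert a b c; decide
    obtain ⟨e, h0, h1, h2, -⟩ := exists_perm4 a b c x hab hac hx.1 hbc hx.2.1 hx.2.2
    have := (cases_concrete _ (hD.comp e)).2.1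
    simpa only [bT_comp, h0, h1, h2] using this

lemma bT_23 {D : Fin 5 → Fin 5 → Fin 5 → Fin 5 → ℂ} (hD : EW D) (α β l m : Fin 5) :
    bT D α β l m = bT D α l β m := by
  by_cases h23 : β = l
  · rw [h23]
  by_cases h14 : α = m
  · subst h14
    rw [bT_pair hD α l, bT_12 β, bT_34 hD]
  by_cases h12 : α = β
  · subst h12
    exact bT_aabc hD _ _ _ h23 h14
  by_cases h13 : α = l
  · subst h13
    exact (bT_aabc hD _ _ _ h12 h14).symm
  by_cases h24 : β = m
  · subst h24
    rw [bT_pair hD α l, bT_aabc hD β α l (Ne.symm h12) h23, bT_12, bT_34 hD]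
  by_cases h34 : l = m
  · subst h34
    rw [bT_pair hD, bT_aabc hD l α β (Ne.symm h13) (Ne.symm h23), bT_12, bT_34 hD]
  obtain ⟨e, h0, h1, h2, h3⟩ := exists_perm4 α β l m h12 h13 h14 h23 h24 h34
  have := (cases_concrete _ (hD.comp e)).1
  simpa only [bT_comp, h0, h1, h2, h3] using this

/-- Signs of the metric. -/
def eps (a : Fin 5) : ℝ := if (a : ℕ) = 0 then -1 else 1

/-- Complex square roots of the signs of the metric. -/
def wk (a : Fin 5) : ℂ := if (a : ℕ) = 0 then Complex.I else 1

lemma wk_sq (a : Fin 5) : wk a * wk a = (eps a : ℂ) := by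
  unfold wk eps; split_ifs <;> simp

lemma eps_sq (a : Fin 5) : (eps a : ℂ) * eps a = 1 := by
  unfold eps; split_ifs <;> simp

lemma wk_ne (a : Fin 5) : wk a ≠ 0 := by
  unfold wk; split_ifs <;> simp

lemma gsum (F : Fin 5 → Fin 5 → ℝ) :
    (∑ ρ : Fin 5, ∑ ρ' : Fin 5, gmet 5 ρ ρ' * F ρ ρ') = ∑ ρ : Fin 5, eps ρ * F ρ ρ := by
  refine Finset.sum_congr rfl fun ρ _ => ?_
  simp [gmet, eps]

/-- The complexified tensor. -/
def cD (C : Fin 5 → Fin 5 → Fin 5 → Fin 5 → ℝ) (a b c d : Fin 5) : ℂ :=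
  wk a * wk b * wk c * wk d * (C a b c d : ℂ)

lemma cD_EW {C : Fin 5 → Fin 5 → Fin 5 → Fin 5 → ℝ} (hC : IsWeylCandidate 5 C) : EW (cD C) := by
  obtain ⟨h1, h2, h3, h4, h5⟩ := hC
  constructor
  · intro a b c d
    unfold cD; rw [h1 a b c d]; push_cast; ring
  · intro a b c d
    unfold cD; rw [h2 a b c d]; push_cast; ring
  · intro a b c d
    unfold cD; rw [h3 a b c d]; ring
  · intro a b c d
    have h : (C a b c d : ℂ) + C a c d b + C a d b c = 0 := by exact_mod_cast h4 a b c d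
    unfold cD
    linear_combination wk a * wk b * wk c * wk d * h
  · intro b d
    have h := h5 b d
    rw [gsum (fun a c => C a b c d)] at h
    have h' : (∑ a : Fin 5, (eps a : ℂ) * (C a b a d : ℂ)) = 0 := by exact_mod_cast h
    have : (∑ a : Fin 5, cD C a b a d) = wk b * wk d * ∑ a : Fin 5, (eps a : ℂ) * (C a b a d : ℂ) := by
      rw [Finset.mul_sum]
      refine Finset.sum_congr rfl fun a _ => ?_
      rw [← wk_sq, cD]; ring
    rw [this, h', mul_zero]

/-- Real contraction. -/
def rP (C : Fin 5 → Fin 5 → Fin 5 → Fin 5 → ℝ) (α β l m : Fin 5) : ℝ :=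
  ∑ ρ : Fin 5, eps ρ * ∑ σ : Fin 5, eps σ * (C α ρ l σ * C β ρ m σ)

/-- Real contraction. -/
def rQ (C : Fin 5 → Fin 5 → Fin 5 → Fin 5 → ℝ) (l m : Fin 5) : ℝ :=
  ∑ ρ : Fin 5, eps ρ * rP C ρ ρ l m

lemma belT_eq {C : Fin 5 → Fin 5 → Fin 5 → Fin 5 → ℝ} (hC : IsWeylCandidate 5 C)
    (α β l m : Fin 5) :
    belT 5 C α β l m = rP C α β l m + rP C α β m l - 1 / 2 * gmet 5 α β * rQ C l m
      - 1 / 2 * gmet 5 l m * rQ C α β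
      + 1 / 8 * gmet 5 α β * gmet 5 l m * ∑ i : Fin 5, eps i * rQ C i i := by
  obtain ⟨-, -, h3, -, -⟩ := hC
  have e1 : ∀ α β l m, (∑ ρ : Fin 5, ∑ ρ' : Fin 5, ∑ σ : Fin 5, ∑ σ' : Fin 5,
      gmet 5 ρ ρ' * gmet 5 σ σ' * C α ρ l σ * C β ρ' m σ') = rP C α β l m := by
    intro α β l m
    simp only [mul_assoc, ← Finset.mul_sum]
    simp only [gsum, rP]
  have e2 : ∀ l m, (∑ ρ : Fin 5, ∑ ρ' : Fin 5, ∑ τ : Fin 5, ∑ τ' : Fin 5, ∑ σ : Fin 5,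
      ∑ σ' : Fin 5, gmet 5 ρ ρ' * gmet 5 τ τ' * gmet 5 σ σ' * C ρ τ l σ * C ρ' τ' m σ')
      = rQ C l m := by
    intro l m
    simp only [mul_assoc, ← Finset.mul_sum]
    simp only [gsum, rP, rQ]
  have e3 : (∑ ρ : Fin 5, ∑ ρ' : Fin 5, ∑ σ : Fin 5, ∑ σ' : Fin 5, ∑ τ : Fin 5, ∑ τ' : Fin 5,
        gmet 5 ρ ρ' * gmet 5 σ σ' * gmet 5 τ τ' * C α ρ σ τ * C β ρ' σ' τ') = rQ C α β := by
    simp only [mul_assoc, ← Finset.mul_sum]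
    simp only [gsum, rP, rQ]
    simp only [Finset.mul_sum]
    rw [Finset.sum_comm]
    refine Finset.sum_congr rfl fun σ _ => ?_
    rw [Finset.sum_comm]
    refine Finset.sum_congr rfl fun τ _ => Finset.sum_congr rfl fun ρ _ => ?_
    rw [h3 α, h3 β]; ring
  have e4 : (∑ ρ : Fin 5, ∑ ρ' : Fin 5, ∑ τ : Fin 5, ∑ τ' : Fin 5, ∑ σ : Fin 5, ∑ σ' : Fin 5,
       ∑ ν : Fin 5, ∑ ν' : Fin 5,
        gmet 5 ρ ρ' * gmet 5 τ τ' * gmet 5 σ σ' * gmet 5 ν ν' * C ρ τ σ ν * C ρ' τ' σ' ν')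
      = ∑ i : Fin 5, eps i * rQ C i i := by
    simp only [mul_assoc, ← Finset.mul_sum]
    simp only [gsum, rP, rQ]
    simp only [Finset.mul_sum]
    have : ∀ F : Fin 5 → Fin 5 → Fin 5 → Fin 5 → ℝ,
        (∑ a, ∑ b, ∑ c, ∑ d, F a b c d) = ∑ c, ∑ a, ∑ b, ∑ d, F a b c d := by
      intro F
      conv_rhs => rw [Finset.sum_comm]
      exact Finset.sum_congr rfl fun a _ => Finset.sum_comm
    rw [this]
    refine Finset.sum_congr rfl fun _ _ => Finset.sum_congr rfl fun _ _ =>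
      Finset.sum_congr rfl fun _ _ => Finset.sum_congr rfl fun _ _ => ?_
    ring
  unfold belT
  rw [e1, e1, e2, e3, e4]

lemma bP_cD (C : Fin 5 → Fin 5 → Fin 5 → Fin 5 → ℝ) (α β l m : Fin 5) :
    bP (cD C) α β l m = wk α * wk β * wk l * wk m * (rP C α β l m : ℂ) := by
  unfold bP rP
  push_cast
  simp only [Finset.mul_sum]
  refine Finset.sum_congr rfl fun ρ _ => Finset.sum_congr rfl fun σ _ => ?_
  rw [← wk_sq, ← wk_sq, cD, cD]; ring

lemma bQ_cD (C : Fin 5 → Fin 5 → Fin 5 → Fin 5 → ℝ) (l m : Fin 5) :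
    bQ (cD C) l m = wk l * wk m * (rQ C l m : ℂ) := by
  unfold bQ rQ
  push_cast
  simp only [Finset.mul_sum]
  refine Finset.sum_congr rfl fun ρ _ => ?_
  rw [← wk_sq, bP_cD]; ring

lemma kd_wk (a b : Fin 5) : kd a b = wk a * wk b * (gmet 5 a b : ℂ) := by
  by_cases h : a = b
  · subst h
    rw [wk_sq]
    have : gmet 5 a a = eps a := by simp [gmet, eps]
    rw [this, eps_sq]; simp [kd]
  · simp [kd, gmet, h]

lemma bT_cD {C : Fin 5 → Fin 5 → Fin 5 → Fin 5 → ℝ} (hC : IsWeylCandidate 5 C)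
    (α β l m : Fin 5) :
    bT (cD C) α β l m = wk α * wk β * wk l * wk m * (belT 5 C α β l m : ℂ) := by
  have hN : (∑ i : Fin 5, bQ (cD C) i i) = ((∑ i : Fin 5, eps i * rQ C i i : ℝ) : ℂ) := by
    push_cast
    refine Finset.sum_congr rfl fun i _ => ?_
    rw [bQ_cD, wk_sq]
  rw [belT_eq hC, bT, hN]
  simp only [bP_cD, bQ_cD, kd_wk]
  push_cast
  ring

lemma belT_perm_of {C : Fin 5 → Fin 5 → Fin 5 → Fin 5 → ℝ} (hC : IsWeylCandidate 5 C)
    {a b c d a' b' c' d' : Fin 5} (hw : wk a * wk b * wk c * wk d = wk a' * wk b' * wk c' * wk d')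
    (h : bT (cD C) a b c d = bT (cD C) a' b' c' d') : belT 5 C a b c d = belT 5 C a' b' c' d' := by
  rw [bT_cD hC, bT_cD hC, ← hw] at h
  have := mul_left_cancel₀ (by simp [wk_ne]) h
  exact_mod_cast this

/-- in dimension 5, the generalized Bel–Robinson tensor of a Weyl candidate
is completely symmetric (invariant under every permutation of its four indices). -/
theorem belRobinson_completely_symmetric_dim5
    (C : Fin 5 → Fin 5 → Fin 5 → Fin 5 → ℝ) (hC : IsWeylCandidate 5 C) :
    ∀ (π : Equiv.Perm (Fin 4)) (v : Fin 4 → Fin 5),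
      belT 5 C (v (π 0)) (v (π 1)) (v (π 2)) (v (π 3))
        = belT 5 C (v 0) (v 1) (v 2) (v 3) := by
  intro π
  have hD := cD_EW hC
  have key : ∀ π ∈ Submonoid.closure
      (Set.range fun i : Fin 3 ↦ Equiv.swap i.castSucc i.succ), ∀ v : Fin 4 → Fin 5,
      belT 5 C (v (π 0)) (v (π 1)) (v (π 2)) (v (π 3)) = belT 5 C (v 0) (v 1) (v 2) (v 3) := by
    intro π hπ
    induction hπ using Submonoid.closure_induction with
    | mem x hx =>
      obtain ⟨i, rfl⟩ := hx
      intro v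
      fin_cases i
      · exact belT_perm_of hC (a := v 1) (b := v 0) (c := v 2) (d := v 3) (by ring) (bT_12 _ _ _ _)
      · exact belT_perm_of hC (a := v 0) (b := v 2) (c := v 1) (d := v 3) (by ring) (bT_23 hD _ _ _ _)
      · exact belT_perm_of hC (a := v 0) (b := v 1) (c := v 3) (d := v 2) (by ring) (bT_34 hD _ _ _ _)
    | one => intro v; rfl
    | mul x y _ _ hx hy =>
      intro v
      have h := hy (v ∘ x)
      simp only [Function.comp] at h
      simp only [Equiv.Perm.mul_apply]
      rw [h, hx v]
  exact key π (by rw [Equiv.Perm.mclosure_swap_castSucc_succ]; trivial)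
end
end

section
/- Let n ≥ 3 and let R be a Riemann candidate on n-dimensional Minkowski space, with Ricci tensor Ric and Weyl part C. Then the generalized Bel tensor of R coincides with the generalized Bel–Robinson tensor of C, i.e. B{R}_{αβλμ} = B{C}_{αβλμ} for all indices, if and only if Ric_{μν} = 0 for all μ, ν. -/
open Finset

noncomputable section

/-- A Riemann candidate: pair antisymmetries, pair interchange symmetry, and
the first Bianchi identity. -/
def IsRiemannCandidate (n : ℕ) (R : Fin n → Fin n → Fin n → Fin n → ℝ) : Prop :=
  (∀ a b c d, R a b c d = - R b a c d) ∧
  (∀ a b c d, R a b c d = - R a b d c) ∧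
  (∀ a b c d, R a b c d = R c d a b) ∧
  (∀ a b c d, R a b c d + R a c d b + R a d b c = 0)

/-- The Ricci tensor `Ric_{βμ} = η^{αλ} R_{αβλμ}` of a Riemann candidate. -/
def ricci (n : ℕ) (R : Fin n → Fin n → Fin n → Fin n → ℝ) (b d : Fin n) : ℝ :=
  ∑ a : Fin n, ∑ c : Fin n, gmet n a c * R a b c d

/-- The scalar curvature `s = η^{βμ} Ric_{βμ}` of a Riemann candidate. -/
def scalarCurv (n : ℕ) (R : Fin n → Fin n → Fin n → Fin n → ℝ) : ℝ :=
  ∑ b : Fin n, ∑ d : Fin n, gmet n b d * ricci n R b d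

/-- The Weyl part of a Riemann candidate. -/
def weylPart (n : ℕ) (R : Fin n → Fin n → Fin n → Fin n → ℝ) (a b c d : Fin n) : ℝ :=
  R a b c d
    - (1 / ((n : ℝ) - 2)) *
        (ricci n R a c * gmet n b d - ricci n R a d * gmet n b c
          - ricci n R b c * gmet n a d + ricci n R b d * gmet n a c)
    + (scalarCurv n R / (((n : ℝ) - 1) * ((n : ℝ) - 2))) *
        (gmet n a c * gmet n b d - gmet n a d * gmet n b c)

/-- The diagonal signs of the metric. -/
def esgn (n : ℕ) (μ : Fin n) : ℝ := if (μ : ℕ) = 0 then -1 else 1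

lemma gmet_sum (n : ℕ) (μ : Fin n) (f : Fin n → ℝ) :
    ∑ ν, gmet n μ ν * f ν = esgn n μ * f μ := by
  simp [gmet, esgn, ite_mul]

lemma gmet_comm (n : ℕ) (a b : Fin n) : gmet n a b = gmet n b a := by
  unfold gmet
  by_cases h : a = b
  · subst h; rfl
  · rw [if_neg h, if_neg (Ne.symm h)]

lemma gmet_sum_left (n : ℕ) (μ : Fin n) (f : Fin n → ℝ) :
    ∑ ν, gmet n ν μ * f ν = esgn n μ * f μ := by
  rw [← gmet_sum]; simp only [gmet_comm n _ μ]

lemma esgn_sq (n : ℕ) (μ : Fin n) : esgn n μ * esgn n μ = 1 := by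
  unfold esgn; split_ifs <;> norm_num

lemma gmet_self (n : ℕ) (μ : Fin n) : gmet n μ μ = esgn n μ := by
  simp [gmet, esgn]

lemma esgn_sum (m : ℕ) (f : Fin (m+1) → ℝ) :
    ∑ μ, esgn (m+1) μ * f μ = ∑ μ, f μ - 2 * f 0 := by
  rw [Fin.sum_univ_succ, Fin.sum_univ_succ]
  simp [esgn]; ring

/-- The fully timelike component of the Bel tensor is a sum of squares. -/
lemma belT_zero (m : ℕ) (X : Fin (m+1) → Fin (m+1) → Fin (m+1) → Fin (m+1) → ℝ)
    (h1 : ∀ a b c d, X a b c d = - X b a c d) (h2 : ∀ a b c d, X a b c d = - X a b d c) :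
    belT (m+1) X 0 0 0 0 = (1/8) * ∑ a, ∑ b, ∑ c, ∑ d, X a b c d * X a b c d := by
  have z1 : ∀ c d, X 0 0 c d = 0 := fun c d => by linarith [h1 0 0 c d]
  have z2 : ∀ a b, X a b 0 0 = 0 := fun a b => by linarith [h2 a b 0 0]
  have s1 : ∀ a c d, X a 0 c d * X a 0 c d = X 0 a c d * X 0 a c d := fun a c d => by
    rw [h1 a 0 c d]; ring
  have s2 : ∀ a b c, X a b c 0 * X a b c 0 = X a b 0 c * X a b 0 c := fun a b c => by
    rw [h2 a b c 0]; ring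
  have g0 : gmet (m+1) 0 0 = -1 := by simp [gmet]
  unfold belT
  simp only [g0, mul_assoc, ← Finset.mul_sum, gmet_sum]
  simp only [esgn_sum, z1, z2, Finset.sum_sub_distrib, ← Finset.mul_sum, mul_zero,
    Finset.sum_const_zero, sub_zero]
  simp only [s1]
  simp only [s2]
  ring

lemma ricci_eq (n : ℕ) (R : Fin n → Fin n → Fin n → Fin n → ℝ) (b d : Fin n) :
    ricci n R b d = ∑ a, esgn n a * R a b a d := by
  unfold ricci; simp only [gmet_sum]

lemma ricci_symm (n : ℕ) (R : Fin n → Fin n → Fin n → Fin n → ℝ)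
    (h3 : ∀ a b c d, R a b c d = R c d a b) (b d : Fin n) :
    ricci n R b d = ricci n R d b := by
  simp only [ricci_eq]
  exact Finset.sum_congr rfl fun a _ => by rw [h3]

lemma scalarCurv_eq (n : ℕ) (R : Fin n → Fin n → Fin n → Fin n → ℝ) :
    scalarCurv n R = ∑ a, esgn n a * ricci n R a a := by
  unfold scalarCurv; simp only [gmet_sum]

lemma ricci_weyl (n : ℕ) (hn : 3 ≤ n) (R : Fin n → Fin n → Fin n → Fin n → ℝ)
    (h3 : ∀ a b c d, R a b c d = R c d a b) (b d : Fin n) :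
    ricci n (weylPart n R) b d = 0 := by
  have hn' : (3:ℝ) ≤ n := by exact_mod_cast hn
  have e1 : ∑ a, esgn n a * (ricci n R a d * gmet n b a) = ricci n R b d := by
    have := gmet_sum n b (fun a => esgn n a * ricci n R a d)
    rw [← mul_assoc, esgn_sq, one_mul] at this
    rw [← this]; exact Finset.sum_congr rfl fun a _ => by ring
  have e2 : ∑ a, esgn n a * (ricci n R b a * gmet n a d) = ricci n R b d := by
    have := gmet_sum_left n d (fun a => esgn n a * ricci n R b a)
    rw [← mul_assoc, esgn_sq, one_mul] at this
    rw [← this]; exact Finset.sum_congr rfl fun a _ => by ring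
  have e3 : ∑ a, esgn n a * (gmet n a d * gmet n b a) = gmet n b d := by
    have := gmet_sum n b (fun a => esgn n a * gmet n a d)
    rw [← mul_assoc, esgn_sq, one_mul] at this
    rw [← this]; exact Finset.sum_congr rfl fun a _ => by ring
  have e4 : ∑ a : Fin n, esgn n a * gmet n a a = n := by
    simp [gmet_self, esgn_sq]
  have key : ricci n (weylPart n R) b d = ∑ a, esgn n a * R a b a d
      - (1 / ((n : ℝ) - 2)) * ((∑ a, esgn n a * ricci n R a a) * gmet n b d
          - ∑ a, esgn n a * (ricci n R a d * gmet n b a)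
          - ∑ a, esgn n a * (ricci n R b a * gmet n a d)
          + ricci n R b d * ∑ a, esgn n a * gmet n a a)
      + (scalarCurv n R / (((n : ℝ) - 1) * ((n : ℝ) - 2))) *
        ((∑ a, esgn n a * gmet n a a) * gmet n b d
          - ∑ a, esgn n a * (gmet n a d * gmet n b a)) := by
    rw [ricci_eq]
    simp only [Finset.mul_sum, Finset.sum_mul, ← Finset.sum_sub_distrib, ← Finset.sum_add_distrib]
    exact Finset.sum_congr rfl fun a _ => by unfold weylPart; ring
  rw [key, e1, e2, e3, e4, ← scalarCurv_eq, ← ricci_eq]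
  have : (n:ℝ) - 2 ≠ 0 := by linarith
  have : (n:ℝ) - 1 ≠ 0 := by linarith
  field_simp
  ring

/-- A trace-free tensor is orthogonal, in the Euclidean inner product of components, to any
tensor built from the metric and a two-tensor. -/
lemma cross_zero (n : ℕ) (C : Fin n → Fin n → Fin n → Fin n → ℝ)
    (h1 : ∀ a b c d, C a b c d = - C b a c d) (h2 : ∀ a b c d, C a b c d = - C a b d c)
    (ht : ∀ b d, ricci n C b d = 0) (S : Fin n → Fin n → ℝ) :
    ∑ a, ∑ b, ∑ c, ∑ d, C a b c d * (S a c * gmet n b d - S a d * gmet n b c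
      - S b c * gmet n a d + S b d * gmet n a c) = 0 := by
  have t1 : ∑ a, ∑ b, ∑ c, ∑ d, C a b c d * (S b d * gmet n a c) = 0 := by
    rw [Finset.sum_comm]
    refine Finset.sum_eq_zero fun b _ => ?_
    have : ∀ a, ∑ c, ∑ d, C a b c d * (S b d * gmet n a c)
        = ∑ d, ∑ c, C a b c d * (S b d * gmet n a c) := fun a => Finset.sum_comm
    simp only [this]
    rw [Finset.sum_comm]
    refine Finset.sum_eq_zero fun d _ => ?_
    have h := ht b d
    unfold ricci at h
    rw [← mul_zero (S b d), ← h]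
    simp only [Finset.mul_sum]
    exact Finset.sum_congr rfl fun a _ => Finset.sum_congr rfl fun c _ => by ring
  have t2 : ∑ a, ∑ b, ∑ c, ∑ d, C a b c d * (S b c * gmet n a d) = 0 := by
    rw [← neg_eq_zero, ← t1]
    simp only [← Finset.sum_neg_distrib]
    refine Finset.sum_congr rfl fun a _ => Finset.sum_congr rfl fun b _ => ?_
    rw [Finset.sum_comm]
    exact Finset.sum_congr rfl fun c _ => Finset.sum_congr rfl fun d _ => by
      rw [h2 a b c d]; ring
  have t3 : ∑ a, ∑ b, ∑ c, ∑ d, C a b c d * (S a d * gmet n b c) = 0 := by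
    rw [← neg_eq_zero, ← t1, Finset.sum_comm]
    simp only [← Finset.sum_neg_distrib]
    exact Finset.sum_congr rfl fun a _ => Finset.sum_congr rfl fun b _ =>
      Finset.sum_congr rfl fun c _ => Finset.sum_congr rfl fun d _ => by
      rw [h1 a b c d]; ring
  have t4 : ∑ a, ∑ b, ∑ c, ∑ d, C a b c d * (S a c * gmet n b d) = 0 := by
    rw [← neg_eq_zero, ← t2, Finset.sum_comm]
    simp only [← Finset.sum_neg_distrib]
    exact Finset.sum_congr rfl fun a _ => Finset.sum_congr rfl fun b _ =>
      Finset.sum_congr rfl fun c _ => Finset.sum_congr rfl fun d _ => by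
      rw [h1 a b c d]; ring
  simp only [mul_add, mul_sub, Finset.sum_add_distrib, Finset.sum_sub_distrib, t1, t2, t3, t4]
  ring

/-- the generalized Bel tensor of a Riemann candidate coincides with the
generalized Bel–Robinson tensor of its Weyl part if and only if the Ricci tensor vanishes. -/
theorem bel_eq_belRobinson_iff_ricci_flat
    (n : ℕ) (hn : 3 ≤ n)
    (R : Fin n → Fin n → Fin n → Fin n → ℝ) (hR : IsRiemannCandidate n R) :
    (∀ a b c d : Fin n, belT n R a b c d = belT n (weylPart n R) a b c d)
      ↔ (∀ b d : Fin n, ricci n R b d = 0) := by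
  obtain ⟨h1, h2, h3, -⟩ := hR
  constructor
  · intro h
    obtain ⟨m, rfl⟩ : ∃ m, n = m + 1 := ⟨n - 1, by omega⟩
    have hsym := ricci_symm (m+1) R h3
    have c1 : ∀ a b c d, weylPart (m+1) R a b c d = - weylPart (m+1) R b a c d := by
      intro a b c d
      unfold weylPart
      rw [h1 a b c d]; ring
    have c2 : ∀ a b c d, weylPart (m+1) R a b c d = - weylPart (m+1) R a b d c := by
      intro a b c d
      unfold weylPart
      rw [h2 a b c d]; ring
    have ct := ricci_weyl (m+1) hn R h3
    have hB := h 0 0 0 0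
    rw [belT_zero m R h1 h2, belT_zero m _ c1 c2] at hB
    let K : Fin (m+1) → Fin (m+1) → Fin (m+1) → Fin (m+1) → ℝ :=
      fun a b c d => R a b c d - weylPart (m+1) R a b c d
    let S : Fin (m+1) → Fin (m+1) → ℝ := fun a b =>
      (1 / (((m+1 : ℕ) : ℝ) - 2)) * ricci (m+1) R a b
      - (scalarCurv (m+1) R / ((((m+1 : ℕ) : ℝ) - 1) * (((m+1 : ℕ) : ℝ) - 2))) / 2
        * gmet (m+1) a b
    have hK : ∀ a b c d, K a b c d = S a c * gmet (m+1) b d - S a d * gmet (m+1) b c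
      - S b c * gmet (m+1) a d + S b d * gmet (m+1) a c := by
      intro a b c d
      simp only [K, S, weylPart]
      ring
    have hx := cross_zero (m+1) _ c1 c2 ct S
    simp only [← hK] at hx
    have hsum : ∑ a, ∑ b, ∑ c, ∑ d, K a b c d * K a b c d = 0 := by
      have : ∑ a, ∑ b, ∑ c, ∑ d, R a b c d * R a b c d
          = ∑ a, ∑ b, ∑ c, ∑ d, weylPart (m+1) R a b c d * weylPart (m+1) R a b c d
          + 2 * ∑ a, ∑ b, ∑ c, ∑ d, weylPart (m+1) R a b c d * K a b c d
          + ∑ a, ∑ b, ∑ c, ∑ d, K a b c d * K a b c d := by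
        simp only [Finset.mul_sum, ← Finset.sum_add_distrib]
        exact Finset.sum_congr rfl fun a _ => Finset.sum_congr rfl fun b _ =>
          Finset.sum_congr rfl fun c _ => Finset.sum_congr rfl fun d _ => by
          simp only [K]; ring
      rw [hx] at this
      linarith
    have n1 : ∀ a b c, 0 ≤ ∑ d, K a b c d * K a b c d := fun a b c =>
      Finset.sum_nonneg fun d _ => mul_self_nonneg _
    have n2 : ∀ a b, 0 ≤ ∑ c, ∑ d, K a b c d * K a b c d := fun a b =>
      Finset.sum_nonneg fun c _ => n1 a b c
    have n3 : ∀ a, 0 ≤ ∑ b, ∑ c, ∑ d, K a b c d * K a b c d := fun a =>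
      Finset.sum_nonneg fun b _ => n2 a b
    have hz : ∀ a b c d, K a b c d = 0 := by
      intro a b c d
      have q1 := (Finset.sum_eq_zero_iff_of_nonneg fun a _ => n3 a).1 hsum a (Finset.mem_univ a)
      have q2 := (Finset.sum_eq_zero_iff_of_nonneg fun b _ => n2 a b).1 q1 b (Finset.mem_univ b)
      have q3 := (Finset.sum_eq_zero_iff_of_nonneg fun c _ => n1 a b c).1 q2 c (Finset.mem_univ c)
      have q4 := (Finset.sum_eq_zero_iff_of_nonneg fun d _ => mul_self_nonneg (K a b c d)).1 q3 d
        (Finset.mem_univ d)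
      exact mul_self_eq_zero.1 q4
    have hRC : R = weylPart (m+1) R := by
      funext a b c d
      exact sub_eq_zero.1 (hz a b c d)
    intro b d
    rw [hRC]
    exact ct b d
  · intro h
    have hs : scalarCurv n R = 0 := by
      unfold scalarCurv
      simp [h]
    have hRC : weylPart n R = R := by
      funext a b c d
      simp [weylPart, h, hs]
    intro a b c d
    rw [hRC]
end
end

section
/- Let φ : ℝⁿ → ℝ be a C^∞ function satisfying the flat wave equation η^{μν} ∂_μ∂_ν φ = 0 everywhere. Then the super-energy tensor field of φ is divergence-free: η^{ρα} ∂_ρ S_{αβλμ} = 0 at every point, for all β, λ, μ. -/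
open Finset

noncomputable section

/-- The partial derivative `∂_μ f` of a scalar field on flat spacetime `ℝⁿ`. -/
def pd (n : ℕ) (μ : Fin n) (f : (Fin n → ℝ) → ℝ) : (Fin n → ℝ) → ℝ :=
  fun x => fderiv ℝ f x (Pi.single μ 1)

/-- The super-energy tensor field `S_{αβλμ}` of a scalar field `φ` on flat spacetime. -/
def seS (n : ℕ) (φ : (Fin n → ℝ) → ℝ) (α β lam mu : Fin n) (x : Fin n → ℝ) : ℝ :=
  pd n α (pd n lam φ) x * pd n mu (pd n β φ) x
    + pd n α (pd n mu φ) x * pd n lam (pd n β φ) x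
    - gmet n α β *
        (∑ ρ : Fin n, ∑ σ : Fin n, gmet n ρ σ * pd n lam (pd n ρ φ) x * pd n mu (pd n σ φ) x)
    - gmet n lam mu *
        (∑ ρ : Fin n, ∑ σ : Fin n, gmet n ρ σ * pd n α (pd n ρ φ) x * pd n β (pd n σ φ) x)
    + (1 / 2) * gmet n α β * gmet n lam mu *
        (∑ ρ : Fin n, ∑ τ : Fin n, ∑ σ : Fin n, ∑ ν : Fin n,
          gmet n ρ τ * gmet n σ ν * pd n ρ (pd n σ φ) x * pd n τ (pd n ν φ) x)

/-- Diagonal entries of the metric. -/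
def sgn0 (n : ℕ) (μ : Fin n) : ℝ := if (μ : ℕ) = 0 then -1 else 1

lemma gmet_eq (n : ℕ) (μ ν : Fin n) : gmet n μ ν = if μ = ν then sgn0 n μ else 0 := rfl

lemma sgn0_sq (n : ℕ) (μ : Fin n) : sgn0 n μ * sgn0 n μ = 1 := by
  unfold sgn0; split_ifs <;> norm_num

lemma pd_smooth (n : ℕ) (μ : Fin n) (f : (Fin n → ℝ) → ℝ) (hf : ContDiff ℝ (⊤ : ℕ∞) f) :
    ContDiff ℝ (⊤ : ℕ∞) (pd n μ f) := by
  unfold pd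
  exact (hf.fderiv_right (m := (⊤ : ℕ∞)) (by simp)).clm_apply contDiff_const

lemma pd_comm (n : ℕ) (μ ν : Fin n) (f : (Fin n → ℝ) → ℝ) (hf : ContDiff ℝ (⊤ : ℕ∞) f) :
    pd n μ (pd n ν f) = pd n ν (pd n μ f) := by
  funext x
  have hd : DifferentiableAt ℝ (fderiv ℝ f) x :=
    ((hf.fderiv_right (m := (⊤ : ℕ∞)) (by simp)).differentiable (by simp)) x
  have key : ∀ a b : Fin n, pd n a (pd n b f) x
      = fderiv ℝ (fderiv ℝ f) x (Pi.single a 1) (Pi.single b 1) := by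
    intro a b
    unfold pd
    rw [fderiv_clm_apply hd (differentiableAt_const _)]
    simp
  rw [key, key]
  have := (hf.contDiffAt (x := x)).isSymmSndFDerivAt (by simp; exact WithTop.coe_le_coe.2 (le_top : (2 : ℕ∞) ≤ ⊤))
  exact this _ _

lemma pd_mul (n : ℕ) (μ : Fin n) (f g : (Fin n → ℝ) → ℝ) (hf : Differentiable ℝ f)
    (hg : Differentiable ℝ g) (x) :
    pd n μ (fun y => f y * g y) x = pd n μ f x * g x + f x * pd n μ g x := by
  unfold pd
  rw [fderiv_fun_mul (hf x) (hg x)]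
  simp; ring

lemma pd_add (n : ℕ) (μ : Fin n) (f g : (Fin n → ℝ) → ℝ) (hf : Differentiable ℝ f)
    (hg : Differentiable ℝ g) (x) :
    pd n μ (fun y => f y + g y) x = pd n μ f x + pd n μ g x := by
  unfold pd
  rw [fderiv_fun_add (hf x) (hg x)]
  simp

lemma pd_sub (n : ℕ) (μ : Fin n) (f g : (Fin n → ℝ) → ℝ) (hf : Differentiable ℝ f)
    (hg : Differentiable ℝ g) (x) :
    pd n μ (fun y => f y - g y) x = pd n μ f x - pd n μ g x := by
  unfold pd
  rw [fderiv_fun_sub (hf x) (hg x)]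
  simp

lemma pd_cmul (n : ℕ) (μ : Fin n) (c : ℝ) (f : (Fin n → ℝ) → ℝ) (hf : Differentiable ℝ f) (x) :
    pd n μ (fun y => c * f y) x = c * pd n μ f x := by
  unfold pd
  rw [fderiv_const_mul (hf x)]
  simp

lemma pd_sum (n : ℕ) (μ : Fin n) (f : Fin n → (Fin n → ℝ) → ℝ)
    (hf : ∀ i, Differentiable ℝ (f i)) (x) :
    pd n μ (fun y => ∑ i, f i y) x = ∑ i, pd n μ (f i) x := by
  unfold pd
  rw [fderiv_fun_sum (fun i _ => hf i x)]
  simp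

/-- The super-energy tensor with the diagonal metric sums carried out. -/
lemma seS_eq (n : ℕ) (φ : (Fin n → ℝ) → ℝ) (α β lam mu : Fin n) :
    seS n φ α β lam mu = fun x =>
  pd n α (pd n lam φ) x * pd n mu (pd n β φ) x
    + pd n α (pd n mu φ) x * pd n lam (pd n β φ) x
    - gmet n α β *
        (∑ ρ : Fin n, sgn0 n ρ * (pd n lam (pd n ρ φ) x * pd n mu (pd n ρ φ) x))
    - gmet n lam mu *
        (∑ ρ : Fin n, sgn0 n ρ * (pd n α (pd n ρ φ) x * pd n β (pd n ρ φ) x))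
    + ((1 / 2) * gmet n α β * gmet n lam mu) *
        (∑ ρ : Fin n, ∑ σ : Fin n,
          (sgn0 n ρ * sgn0 n σ) * (pd n ρ (pd n σ φ) x * pd n ρ (pd n σ φ) x)) := by
  funext x
  unfold seS
  have h1 : ∀ A B : Fin n → ℝ, (∑ ρ : Fin n, ∑ σ : Fin n, gmet n ρ σ * A ρ * B σ)
      = ∑ ρ, sgn0 n ρ * (A ρ * B ρ) := by
    intro A B
    simp [gmet_eq, ite_mul, mul_assoc]
  have h2 : (∑ ρ : Fin n, ∑ τ : Fin n, ∑ σ : Fin n, ∑ ν : Fin n,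
          gmet n ρ τ * gmet n σ ν * pd n ρ (pd n σ φ) x * pd n τ (pd n ν φ) x)
      = ∑ ρ : Fin n, ∑ σ : Fin n,
          (sgn0 n ρ * sgn0 n σ) * (pd n ρ (pd n σ φ) x * pd n ρ (pd n σ φ) x) := by
    refine Finset.sum_congr rfl fun ρ _ => ?_
    rw [Finset.sum_comm]
    refine Finset.sum_congr rfl fun σ _ => ?_
    simp [gmet_eq, ite_mul, mul_ite, mul_assoc]
  rw [h1, h1, h2]

/-- the super-energy tensor field of a smooth solution of the flat wave
equation is divergence-free. -/
theorem seS_divergence_free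
    (n : ℕ) (φ : (Fin n → ℝ) → ℝ) (hφ : ContDiff ℝ (⊤ : ℕ∞) φ)
    (hwave : ∀ x : Fin n → ℝ,
      (∑ μ : Fin n, ∑ ν : Fin n, gmet n μ ν * pd n μ (pd n ν φ) x) = 0) :
    ∀ (x : Fin n → ℝ) (β lam mu : Fin n),
      (∑ ρ : Fin n, ∑ α : Fin n, gmet n ρ α * pd n ρ (seS n φ α β lam mu) x) = 0 := by
  intro x β lam mu
  have hH : ∀ a b, Differentiable ℝ (pd n a (pd n b φ)) := fun a b =>
    (pd_smooth n a _ (pd_smooth n b _ hφ)).differentiable (by simp)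
  obtain ⟨T, hT⟩ : ∃ T : Fin n → Fin n → Fin n → ℝ,
    ∀ a b c, pd n a (pd n b (pd n c φ)) x = T a b c := ⟨_, fun _ _ _ => rfl⟩
  obtain ⟨H, hHx⟩ : ∃ H : Fin n → Fin n → ℝ,
    ∀ a b, pd n a (pd n b φ) x = H a b := ⟨_, fun _ _ => rfl⟩
  have Hs : ∀ a b, H a b = H b a := by
    intro a b; rw [← hHx, ← hHx, pd_comm n a b φ hφ]
  have T1 : ∀ a b c, T a b c = T b a c := by
    intro a b c; rw [← hT, ← hT, pd_comm n a b _ (pd_smooth n c _ hφ)]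
  have T2 : ∀ a b c, T a b c = T a c b := by
    intro a b c; rw [← hT, ← hT, pd_comm n b c φ hφ]
  have hbox : ∀ c, ∑ a, sgn0 n a * T a a c = 0 := by
    intro c
    have h0 : (fun y => ∑ a, sgn0 n a * pd n a (pd n a φ) y) = fun _ => 0 := by
      funext y
      rw [← hwave y]
      simp [gmet_eq, ite_mul]
    have h1 : pd n c (fun y => ∑ a, sgn0 n a * pd n a (pd n a φ) y) x = 0 := by
      rw [h0]; simp [pd]
    rw [pd_sum n c _ (fun i => (hH i i).const_mul _)] at h1
    rw [← h1]
    refine Finset.sum_congr rfl fun a _ => ?_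
    rw [pd_cmul n c _ _ (hH a a), hT, T2 a a c, T1 a c a]
  have hd : ∀ r α, pd n r (seS n φ α β lam mu) x =
      (T r α lam * H mu β + H α lam * T r mu β)
      + (T r α mu * H lam β + H α mu * T r lam β)
      - gmet n α β * (∑ ρ, sgn0 n ρ * (T r lam ρ * H mu ρ + H lam ρ * T r mu ρ))
      - gmet n lam mu * (∑ ρ, sgn0 n ρ * (T r α ρ * H β ρ + H α ρ * T r β ρ))
      + ((1 / 2) * gmet n α β * gmet n lam mu) *
        (∑ ρ, ∑ σ, (sgn0 n ρ * sgn0 n σ) * (T r ρ σ * H ρ σ + H ρ σ * T r ρ σ)) := by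
    intro r α
    have hHH : ∀ a b c d, Differentiable ℝ
        (fun y => pd n a (pd n b φ) y * pd n c (pd n d φ) y) :=
      fun a b c d => (hH a b).mul (hH c d)
    have hP : ∀ a b c d, pd n r (fun y => pd n a (pd n b φ) y * pd n c (pd n d φ) y) x
        = T r a b * H c d + H a b * T r c d := by
      intro a b c d
      rw [pd_mul n r _ _ (hH a b) (hH c d), hT, hT, hHx, hHx]
    have hS : ∀ a c, Differentiable ℝ (fun y => ∑ ρ : Fin n, sgn0 n ρ *
        (pd n a (pd n ρ φ) y * pd n c (pd n ρ φ) y)) := fun a c =>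
      Differentiable.fun_sum fun i _ => (hHH a i c i).const_mul _
    have hQ1 : ∀ ρ, Differentiable ℝ (fun y => ∑ σ : Fin n,
          (sgn0 n ρ * sgn0 n σ) * (pd n ρ (pd n σ φ) y * pd n ρ (pd n σ φ) y)) := fun ρ =>
      Differentiable.fun_sum fun i _ => (hHH ρ i ρ i).const_mul _
    have hQ : Differentiable ℝ (fun y => ∑ ρ : Fin n, ∑ σ : Fin n,
          (sgn0 n ρ * sgn0 n σ) * (pd n ρ (pd n σ φ) y * pd n ρ (pd n σ φ) y)) :=
      Differentiable.fun_sum fun i _ => hQ1 i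
    have hA := (hHH α lam mu β).fun_add (hHH α mu lam β)
    have hB := hA.fun_sub ((hS lam mu).const_mul (gmet n α β))
    have hC := hB.fun_sub ((hS α β).const_mul (gmet n lam mu))
    have hSd : ∀ a c, pd n r (fun y => ∑ ρ : Fin n, sgn0 n ρ *
        (pd n a (pd n ρ φ) y * pd n c (pd n ρ φ) y)) x
        = ∑ ρ, sgn0 n ρ * (T r a ρ * H c ρ + H a ρ * T r c ρ) := by
      intro a c
      rw [pd_sum n r _ (fun i => (hHH a i c i).const_mul _)]
      refine Finset.sum_congr rfl fun i _ => ?_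
      rw [pd_cmul n r _ _ (hHH a i c i), hP]
    rw [seS_eq, pd_add n r _ _ hC (hQ.const_mul _), pd_sub n r _ _ hB ((hS α β).const_mul _),
      pd_sub n r _ _ hA ((hS lam mu).const_mul _), pd_add n r _ _ (hHH α lam mu β) (hHH α mu lam β),
      pd_cmul n r _ _ hQ, pd_cmul n r _ _ (hS α β), pd_cmul n r _ _ (hS lam mu),
      hP, hP, hSd, hSd, pd_sum n r _ hQ1]
    congr 2
    refine Finset.sum_congr rfl fun ρ _ => ?_
    rw [pd_sum n r _ (fun i => (hHH ρ i ρ i).const_mul _)]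
    refine Finset.sum_congr rfl fun i _ => ?_
    rw [pd_cmul n r _ _ (hHH ρ i ρ i), hP]
  have hdiag : ∀ F : Fin n → Fin n → ℝ, (∑ ρ, ∑ α, gmet n ρ α * F ρ α)
      = ∑ α, sgn0 n α * F α α := by
    intro F; simp [gmet_eq, ite_mul]
  rw [hdiag (fun ρ α => pd n ρ (seS n φ α β lam mu) x)]
  simp only [hd]
  -- contraction with the metric at index `β`
  have hcon : ∀ F : Fin n → ℝ, ∑ α, sgn0 n α * (gmet n α β * F α) = F β := by
    intro F
    simp [gmet_eq, ite_mul, ← mul_assoc, sgn0_sq]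
  have e1 : ∀ a b, ∑ α, sgn0 n α * (T α α a * H b β + H α a * T α b β)
      = ∑ α, sgn0 n α * (H α a * T α b β) := by
    intro a b
    have : ∑ α, sgn0 n α * (T α α a * H b β) = 0 := by
      simp only [← mul_assoc]
      rw [← Finset.sum_mul, hbox, zero_mul]
    simp only [mul_add, Finset.sum_add_distrib, this, zero_add]
  have e3 : ∑ α, sgn0 n α * (∑ ρ, sgn0 n ρ * (T α α ρ * H β ρ + H α ρ * T α β ρ))
      = ∑ α, ∑ ρ, sgn0 n α * sgn0 n ρ * (H α ρ * T β α ρ) := by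
    have : ∑ α, ∑ ρ, sgn0 n α * (sgn0 n ρ * (T α α ρ * H β ρ)) = 0 := by
      rw [Finset.sum_comm]
      refine Finset.sum_eq_zero fun ρ _ => ?_
      have h : ∀ α, sgn0 n α * (sgn0 n ρ * (T α α ρ * H β ρ))
        = (sgn0 n α * T α α ρ) * (sgn0 n ρ * H β ρ) := fun α => by ring
      simp only [h]
      rw [← Finset.sum_mul, hbox, zero_mul]
    simp only [mul_add, Finset.sum_add_distrib, Finset.mul_sum, this, zero_add]
    refine Finset.sum_congr rfl fun α _ => Finset.sum_congr rfl fun ρ _ => ?_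
    rw [T1 α β ρ]; ring
  have split : ∀ (A B C D E : Fin n → ℝ) (g : ℝ), ∑ α, sgn0 n α *
      (A α + B α - gmet n α β * C α - g * D α + (1 / 2) * gmet n α β * g * E α)
      = ∑ α, sgn0 n α * A α + ∑ α, sgn0 n α * B α - C β - g * ∑ α, sgn0 n α * D α
        + (1 / 2) * g * E β := by
    intro A B C D E g
    rw [← hcon C, ← hcon E, Finset.mul_sum, Finset.mul_sum, ← Finset.sum_add_distrib,
      ← Finset.sum_sub_distrib, ← Finset.sum_sub_distrib, ← Finset.sum_add_distrib]
    refine Finset.sum_congr rfl fun α _ => ?_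
    ring
  rw [split (fun α => T α α lam * H mu β + H α lam * T α mu β)
    (fun α => T α α mu * H lam β + H α mu * T α lam β)
    (fun r => ∑ ρ, sgn0 n ρ * (T r lam ρ * H mu ρ + H lam ρ * T r mu ρ))
    (fun α => ∑ ρ, sgn0 n ρ * (T α α ρ * H β ρ + H α ρ * T α β ρ))
    (fun r => ∑ ρ, ∑ σ, (sgn0 n ρ * sgn0 n σ) * (T r ρ σ * H ρ σ + H ρ σ * T r ρ σ))]
  simp only [e1, e3]
  have f1 : ∑ ρ, sgn0 n ρ * (T β lam ρ * H mu ρ + H lam ρ * T β mu ρ)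
      = ∑ α, sgn0 n α * (H α lam * T α mu β) + ∑ α, sgn0 n α * (H α mu * T α lam β) := by
    rw [← Finset.sum_add_distrib]
    refine Finset.sum_congr rfl fun ρ _ => ?_
    have t : ∀ a, T β a ρ = T ρ a β := fun a => by rw [T2 β a ρ, T1 β ρ a, T2 ρ β a]
    rw [t, t, Hs mu ρ, Hs lam ρ]; ring
  have f2 : ∑ ρ, ∑ σ, (sgn0 n ρ * sgn0 n σ) * (T β ρ σ * H ρ σ + H ρ σ * T β ρ σ)
      = 2 * ∑ α, ∑ ρ, sgn0 n α * sgn0 n ρ * (H α ρ * T β α ρ) := by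
    simp only [Finset.mul_sum]
    refine Finset.sum_congr rfl fun α _ => Finset.sum_congr rfl fun ρ _ => ?_
    ring
  rw [f1, f2]
  ring
end
end
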